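/- Let (x*,λ*) be a saddle point of L, let κ ∈ (0,1], assume the strengthened scaling condition β̇(t) ≤ (1 − κ)β(t)/δ for all t ≥ t₀ and 1/δ < γ, and let (x,λ) be a global solution of the primal-dual dynamical system. Then ∫_{t₀}^{∞} β(t)(L^σ(x(t),λ*) − L^σ(x*,λ(t))) dt < +∞. -/

import Mathlib

open scoped RealInnerProductSpace
open MeasureTheory Set

noncomputable def Lagr {n m : ℕ} (f : EuclideanSpace ℝ (Fin n) → ℝ)
    (A : EuclideanSpace ℝ (Fin n) →L[ℝ] EuclideanSpace ℝ (Fin m))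
    (b : EuclideanSpace ℝ (Fin m))
    (x : EuclideanSpace ℝ (Fin n)) (lam : EuclideanSpace ℝ (Fin m)) : ℝ :=
  f x + ⟪lam, A x - b⟫

noncomputable def AugLagr {n m : ℕ} (f : EuclideanSpace ℝ (Fin n) → ℝ)
    (A : EuclideanSpace ℝ (Fin n) →L[ℝ] EuclideanSpace ℝ (Fin m))
    (b : EuclideanSpace ℝ (Fin m)) (σ : ℝ)
    (x : EuclideanSpace ℝ (Fin n)) (lam : EuclideanSpace ℝ (Fin m)) : ℝ :=
  Lagr f A b x lam + σ / 2 * ‖A x - b‖ ^ 2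

def IsSaddlePoint {n m : ℕ} (f : EuclideanSpace ℝ (Fin n) → ℝ)
    (A : EuclideanSpace ℝ (Fin n) →L[ℝ] EuclideanSpace ℝ (Fin m))
    (b : EuclideanSpace ℝ (Fin m))
    (xs : EuclideanSpace ℝ (Fin n)) (ls : EuclideanSpace ℝ (Fin m)) : Prop :=
  ∀ x lam, Lagr f A b xs lam ≤ Lagr f A b xs ls ∧ Lagr f A b xs ls ≤ Lagr f A b x ls

/-- First-order characterization of convexity. -/
lemma ConvexOn.add_inner_gradient_le {E : Type*} [NormedAddCommGroup E] [InnerProductSpace ℝ E]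
    [CompleteSpace E] {f : E → ℝ} (hf : ConvexOn ℝ univ f) {x : E}
    (hd : DifferentiableAt ℝ f x) (y : E) :
    f x + ⟪gradient f x, y - x⟫ ≤ f y := by
  have hconv : ConvexOn ℝ univ (f ∘ AffineMap.lineMap (k := ℝ) x y) :=
    hf.comp_affineMap (AffineMap.lineMap x y)
  have hderiv : HasDerivAt (f ∘ AffineMap.lineMap (k := ℝ) x y) ⟪gradient f x, y - x⟫ 0 := by
    have h0 : HasFDerivAt f (InnerProductSpace.toDual ℝ E (gradient f x))
        (AffineMap.lineMap (k := ℝ) x y 0) := by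
      simpa using hd.hasGradientAt.hasFDerivAt
    simpa using h0.comp_hasDerivAt (0 : ℝ) AffineMap.hasDerivAt_lineMap
  have h := hconv.le_slope_of_hasDerivAt (mem_univ 0) (mem_univ 1) zero_lt_one hderiv
  simp only [slope_def_field, Function.comp_apply, AffineMap.lineMap_apply_zero,
    AffineMap.lineMap_apply_one, sub_zero, div_one] at h
  linarith

/-- A nonnegative continuous function dominated by the decrease rate of a function bounded
below is integrable. -/
lemma integrableOn_Ici_of_le_neg_deriv {E E' h : ℝ → ℝ} {a c : ℝ} (hc : 0 < c)
    (hE : ∀ t ∈ Ici a, HasDerivWithinAt E (E' t) (Ici a) t) (hE0 : ∀ t ∈ Ici a, 0 ≤ E t)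
    (hcont : ContinuousOn h (Ici a)) (h0 : ∀ t ∈ Ici a, 0 ≤ h t)
    (hle : ∀ t ∈ Ici a, E' t ≤ -(c * h t)) : IntegrableOn h (Ici a) := by
  have hE'0 : ∀ t ∈ Ici a, E' t ≤ 0 := fun t ht =>
    (hle t ht).trans (neg_nonpos.2 (mul_nonneg hc.le (h0 t ht)))
  have hanti : AntitoneOn E (Ici a) :=
    antitoneOn_of_hasDerivWithinAt_nonpos (convex_Ici a)
      (fun t ht => (hE t ht).continuousWithinAt)
      (fun t ht => (hE t (interior_subset ht)).mono interior_subset)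
      (fun t ht => hE'0 t (interior_subset ht))
  have hanti' : Antitone fun t => E (max a t) := fun s t hst =>
    hanti (mem_Ici.2 (le_max_left a s)) (mem_Ici.2 (le_max_left a t)) (max_le_max_left a hst)
  have hlim := tendsto_atTop_ciInf hanti'
    ⟨0, by rintro _ ⟨t, rfl⟩; exact hE0 _ (mem_Ici.2 (le_max_left a t))⟩
  have hlim' := hlim.congr' (f₂ := E) <| by
    filter_upwards [Filter.eventually_ge_atTop a] with t ht
    rw [max_eq_right ht]
  have hint : IntegrableOn E' (Ioi a) :=
    integrableOn_Ioi_deriv_of_nonpos (hE a self_mem_Ici).continuousWithinAt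
      (fun t ht => (hE t (Ioi_subset_Ici_self ht)).hasDerivAt (Ici_mem_nhds ht))
      (fun t ht => hE'0 t (Ioi_subset_Ici_self ht)) hlim'
  rw [integrableOn_Ici_iff_integrableOn_Ioi]
  refine Integrable.mono' (hint.neg.const_mul c⁻¹)
    ((hcont.mono Ioi_subset_Ici_self).aestronglyMeasurable measurableSet_Ioi) ?_
  filter_upwards [ae_restrict_mem measurableSet_Ioi] with t ht
  have ht' : t ∈ Ici a := Ioi_subset_Ici_self ht
  rw [Real.norm_of_nonneg (h0 t ht'), Pi.neg_apply, le_inv_mul_iff₀ hc]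
  linarith [hle t ht']

section AugmentedLagrangian

variable {n m : ℕ} {f : EuclideanSpace ℝ (Fin n) → ℝ}
  {A : EuclideanSpace ℝ (Fin n) →L[ℝ] EuclideanSpace ℝ (Fin m)}
  {b : EuclideanSpace ℝ (Fin m)} {xs : EuclideanSpace ℝ (Fin n)}
  {ls : EuclideanSpace ℝ (Fin m)}

lemma IsSaddlePoint.map_eq (h : IsSaddlePoint f A b xs ls) : A xs = b := by
  have h1 := (h xs (ls + (A xs - b))).1
  simp only [Lagr, inner_add_left, real_inner_self_eq_norm_sq] at h1
  have h2 : ‖A xs - b‖ = 0 := by nlinarith [norm_nonneg (A xs - b)]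
  exact sub_eq_zero.1 (norm_eq_zero.1 h2)

lemma AugLagr_of_map_eq (h : A xs = b) (σ : ℝ) (lam : EuclideanSpace ℝ (Fin m)) :
    AugLagr f A b σ xs lam = f xs := by
  simp [AugLagr, Lagr, h]

lemma IsSaddlePoint.le_AugLagr (h : IsSaddlePoint f A b xs ls) {σ : ℝ} (hσ : 0 < σ)
    (x : EuclideanSpace ℝ (Fin n)) : f xs ≤ AugLagr f A b σ x ls := by
  have h1 := (h x ls).2
  have h2 : Lagr f A b xs ls = f xs := by simp [Lagr, h.map_eq]
  have h3 : 0 ≤ σ / 2 * ‖A x - b‖ ^ 2 := by positivity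
  unfold AugLagr
  linarith

lemma AugLagr_sub_le (hf : ConvexOn ℝ univ f) {x : EuclideanSpace ℝ (Fin n)}
    (hd : DifferentiableAt ℝ f x) {σ : ℝ} (hσ : 0 < σ) (ls : EuclideanSpace ℝ (Fin m)) :
    AugLagr f A b σ x ls - f xs ≤
      ⟪x - xs, gradient f x⟫ + ⟪A x - b, ls⟫ + σ * ‖A x - b‖ ^ 2 := by
  have h1 := hf.add_inner_gradient_le hd xs
  rw [← neg_sub x xs, inner_neg_right, real_inner_comm] at h1
  have h2 : 0 ≤ σ / 2 * ‖A x - b‖ ^ 2 := by positivity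
  rw [AugLagr, Lagr, real_inner_comm]
  linarith

lemma HasDerivWithinAt.AugLagr {x : ℝ → EuclideanSpace ℝ (Fin n)}
    {x' : EuclideanSpace ℝ (Fin n)} {s : Set ℝ} {t : ℝ} (hx : HasDerivWithinAt x x' s t)
    (hd : DifferentiableAt ℝ f (x t)) (σ : ℝ) (ls : EuclideanSpace ℝ (Fin m)) :
    HasDerivWithinAt (fun t => AugLagr f A b σ (x t) ls)
      (⟪gradient f (x t), x'⟫ + ⟪ls, A x'⟫ + σ * ⟪A (x t) - b, A x'⟫) s t := by
  have h1 : HasDerivWithinAt (fun t => f (x t)) ⟪gradient f (x t), x'⟫ s t :=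
    hd.hasGradientAt.hasFDerivAt.comp_hasDerivWithinAt t hx
  have h2 : HasDerivWithinAt (fun t => A (x t) - b) (A x') s t :=
    (A.hasFDerivAt.comp_hasDerivWithinAt t hx).sub_const b
  have h3 := (hasDerivWithinAt_const t s ls).inner ℝ h2
  convert! (h1.add h3).add (h2.norm_sq.const_mul (σ / 2)) using 1
  simp
  ring

end AugmentedLagrangian

/-- Lyapunov function of the primal-dual dynamical system. -/
noncomputable def primalDualEnergy {n m : ℕ} (f : EuclideanSpace ℝ (Fin n) → ℝ)
    (A : EuclideanSpace ℝ (Fin n) →L[ℝ] EuclideanSpace ℝ (Fin m))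
    (b : EuclideanSpace ℝ (Fin m)) (γ δ σ : ℝ) (β : ℝ → ℝ)
    (xs : EuclideanSpace ℝ (Fin n)) (ls : EuclideanSpace ℝ (Fin m))
    (x x' : ℝ → EuclideanSpace ℝ (Fin n)) (lam : ℝ → EuclideanSpace ℝ (Fin m)) (t : ℝ) : ℝ :=
  δ ^ 2 * (β t * (AugLagr f A b σ (x t) ls - f xs)) + 1 / 2 * ‖x t - xs + δ • x' t‖ ^ 2
    + (δ * γ - 1) / 2 * ‖x t - xs‖ ^ 2 + δ / 2 * ‖lam t - ls‖ ^ 2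

/-- The derivative of the Lyapunov function along trajectories. -/
lemma hasDerivWithinAt_primalDualEnergy {n m : ℕ} {f : EuclideanSpace ℝ (Fin n) → ℝ}
    {A : EuclideanSpace ℝ (Fin n) →L[ℝ] EuclideanSpace ℝ (Fin m)}
    {b : EuclideanSpace ℝ (Fin m)} {γ δ σ : ℝ} {β : ℝ → ℝ} {β' : ℝ}
    {xs : EuclideanSpace ℝ (Fin n)} {ls : EuclideanSpace ℝ (Fin m)}
    {x x' : ℝ → EuclideanSpace ℝ (Fin n)} {x'' : EuclideanSpace ℝ (Fin n)}
    {lam : ℝ → EuclideanSpace ℝ (Fin m)} {lam' : EuclideanSpace ℝ (Fin m)} {s : Set ℝ} {t : ℝ}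
    (hfeas : A xs = b) (hd : DifferentiableAt ℝ f (x t)) (hβ : HasDerivWithinAt β β' s t)
    (hx : HasDerivWithinAt x (x' t) s t) (hx' : HasDerivWithinAt x' x'' s t)
    (hlam : HasDerivWithinAt lam lam' s t)
    (hode1 : x'' + γ • x' t =
      -(β t) • (gradient f (x t) + A.adjoint (lam t) + σ • A.adjoint (A (x t) - b)))
    (hode2 : lam' = β t • (A (x t + δ • x' t) - b)) :
    HasDerivWithinAt (primalDualEnergy f A b γ δ σ β xs ls x x' lam)
      (δ ^ 2 * (β' * (AugLagr f A b σ (x t) ls - f xs)) - δ * (δ * γ - 1) * ‖x' t‖ ^ 2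
        - δ * β t * (⟪x t - xs, gradient f (x t)⟫ + ⟪A (x t) - b, ls⟫
          + σ * ‖A (x t) - b‖ ^ 2)) s t := by
  have h1 := (hβ.mul ((hx.AugLagr (A := A) (b := b) hd σ ls).sub_const (f xs))).const_mul (δ ^ 2)
  have h2 := ((hx.sub_const xs).add (hx'.const_smul δ)).norm_sq.const_mul (1 / 2)
  have h3 := (hx.sub_const xs).norm_sq.const_mul ((δ * γ - 1) / 2)
  have h4 := (hlam.sub_const ls).norm_sq.const_mul (δ / 2)
  convert! ((h1.add h2).add h3).add h4 using 1
  have hx''eq : x'' = -γ • x' t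
      - β t • (gradient f (x t) + A.adjoint (lam t) + σ • A.adjoint (A (x t) - b)) := by
    rw [eq_sub_of_add_eq hode1]
    module
  have hlam'eq : lam' = β t • ((A (x t) - b) + δ • A (x' t)) := by
    rw [hode2, map_add, map_smul]
    module
  have hy : A (x t - xs) = A (x t) - b := by rw [map_sub, hfeas]
  rw [hx''eq, hlam'eq]
  simp only [Pi.add_apply, Pi.smul_apply]
  generalize A (x t) - b = w at hy ⊢
  generalize x t - xs = y at hy ⊢
  simp only [map_smul, inner_add_left, inner_add_right, inner_sub_left,
    inner_sub_right, real_inner_smul_left, real_inner_smul_right,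
    ContinuousLinearMap.adjoint_inner_right, hy, real_inner_self_eq_norm_sq]
  rw [real_inner_comm (x' t) (gradient f (x t)), real_inner_comm (A (x' t)) ls,
    real_inner_comm (A (x' t)) w, real_inner_comm w ls, real_inner_comm w (lam t),
    real_inner_comm (A (x' t)) (lam t)]
  ring

theorem strengthened_scaling_integral_finite
    {n m : ℕ}
    (f : EuclideanSpace ℝ (Fin n) → ℝ)
    (hf_conv : ConvexOn ℝ Set.univ f)
    (hf_smooth : ContDiff ℝ 1 f)
    (A : EuclideanSpace ℝ (Fin n) →L[ℝ] EuclideanSpace ℝ (Fin m))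
    (b : EuclideanSpace ℝ (Fin m))
    (t₀ γ δ σ : ℝ) (ht₀ : 0 ≤ t₀) (hγ : 0 < γ) (hδ : 0 < δ) (hσ : 0 < σ)
    (β β' : ℝ → ℝ)
    (hβpos : ∀ t ∈ Ici t₀, 0 < β t)
    (hβderiv : ∀ t ∈ Ici t₀, HasDerivWithinAt β (β' t) (Ici t₀) t)
    (hβ'cont : ContinuousOn β' (Ici t₀))
    (xs : EuclideanSpace ℝ (Fin n)) (ls : EuclideanSpace ℝ (Fin m))
    (hsaddle : IsSaddlePoint f A b xs ls)
    (κ : ℝ) (hκ0 : 0 < κ) (hκ1 : κ ≤ 1)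
    (hscale : ∀ t ∈ Ici t₀, β' t ≤ (1 - κ) * (β t / δ)) (hscale' : 1 / δ < γ)
    (x x' x'' : ℝ → EuclideanSpace ℝ (Fin n))
    (lam lam' : ℝ → EuclideanSpace ℝ (Fin m))
    (hx : ∀ t ∈ Ici t₀, HasDerivWithinAt x (x' t) (Ici t₀) t)
    (hx' : ∀ t ∈ Ici t₀, HasDerivWithinAt x' (x'' t) (Ici t₀) t)
    (hx''cont : ContinuousOn x'' (Ici t₀))
    (hlam : ∀ t ∈ Ici t₀, HasDerivWithinAt lam (lam' t) (Ici t₀) t)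
    (hlam'cont : ContinuousOn lam' (Ici t₀))
    (hode1 : ∀ t ∈ Ici t₀, x'' t + γ • x' t =
      -(β t) • (gradient f (x t) + A.adjoint (lam t) + σ • A.adjoint (A (x t) - b)))
    (hode2 : ∀ t ∈ Ici t₀, lam' t = β t • (A (x t + δ • x' t) - b))
    :
    IntegrableOn (fun t => β t *
      (AugLagr f A b σ (x t) ls - AugLagr f A b σ xs (lam t))) (Ici t₀) := by
  have hfeas := hsaddle.map_eq
  have hdiff : Differentiable ℝ f := hf_smooth.differentiable one_ne_zero
  have hδγ : 0 < δ * γ - 1 := by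
    rw [div_lt_iff₀ hδ] at hscale'
    linarith
  simp only [AugLagr_of_map_eq hfeas]
  have hgap : ∀ t, 0 ≤ AugLagr f A b σ (x t) ls - f xs := fun t =>
    sub_nonneg.2 (hsaddle.le_AugLagr hσ (x t))
  refine integrableOn_Ici_of_le_neg_deriv (mul_pos hδ hκ0)
    (fun t ht => hasDerivWithinAt_primalDualEnergy (ls := ls) hfeas (hdiff (x t)) (hβderiv t ht) (hx t ht)
      (hx' t ht) (hlam t ht) (hode1 t ht) (hode2 t ht)) (fun t ht => ?_) (fun t ht => ?_)
    (fun t ht => mul_nonneg (hβpos t ht).le (hgap t)) (fun t ht => ?_)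
  · have h1 := mul_nonneg (hβpos t ht).le (hgap t)
    unfold primalDualEnergy
    positivity
  · exact ((hβderiv t ht).mul
      (((hx t ht).AugLagr (hdiff (x t)) σ ls).sub_const (f xs))).continuousWithinAt
  · have h1 := mul_le_mul_of_nonneg_left
      (AugLagr_sub_le (A := A) (b := b) (xs := xs) hf_conv (hdiff (x t)) hσ ls)
      (mul_pos hδ (hβpos t ht)).le
    have h2 := mul_le_mul_of_nonneg_left
      (mul_le_mul_of_nonneg_right (hscale t ht) (hgap t)) (sq_nonneg δ)
    have h3 : 0 ≤ δ * (δ * γ - 1) * ‖x' t‖ ^ 2 := by positivity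
    have h4 : δ ^ 2 * ((1 - κ) * (β t / δ) * (AugLagr f A b σ (x t) ls - f xs)) =
        δ * (1 - κ) * (β t * (AugLagr f A b σ (x t) ls - f xs)) := by
      field_simp
    linarith
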